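/- Let u, p be distinct vertices, let L be a latest minimum (u,p)-cut side, and let A be any (u,p)-cut side such that L is not a subset of A. Then cut(A) > cut(L). -/

import Mathlib

open Finset

variable {V : Type*}

/-- The cut value of a set `S`: total weight of pairs crossing `(S, Sᶜ)`. -/
def cutValue [Fintype V] [DecidableEq V] (w : V → V → ℝ) (S : Finset V) : ℝ :=
  ∑ x ∈ S, ∑ y ∈ Sᶜ, w x y

/-- `S` is an `(s,t)`-cut side if `s ∈ S` and `t ∉ S`. -/
def IsCutSide [Fintype V] [DecidableEq V] (s t : V) (S : Finset V) : Prop :=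
  s ∈ S ∧ t ∉ S

/-- `S` is a minimum `(s,t)`-cut side. -/
def IsMinCutSide [Fintype V] [DecidableEq V] (w : V → V → ℝ) (s t : V) (S : Finset V) : Prop :=
  IsCutSide s t S ∧ ∀ S' : Finset V, IsCutSide s t S' → cutValue w S ≤ cutValue w S'

/-- `S` is a latest minimum `(s,t)`-cut side: a minimum cut side of minimum cardinality
among all minimum cut sides. -/
def IsLatestMinCutSide [Fintype V] [DecidableEq V] (w : V → V → ℝ) (s t : V) (S : Finset V) : Prop :=
  IsMinCutSide w s t S ∧ ∀ S' : Finset V, IsMinCutSide w s t S' → S.card ≤ S'.card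

theorem cutValue_eq_sum_ite [Fintype V] [DecidableEq V] (w : V → V → ℝ) (S : Finset V) :
    cutValue w S = ∑ x, ∑ y, if x ∈ S ∧ y ∉ S then w x y else 0 := by
  simp only [cutValue, ite_and, ← mem_compl, sum_ite_irrel, sum_const_zero, sum_ite_mem,
    univ_inter]

/-- The cut function of a nonnegative weight is submodular. -/
theorem cutValue_inter_add_cutValue_union_le [Fintype V] [DecidableEq V] {w : V → V → ℝ}
    (hnonneg : ∀ x y, 0 ≤ w x y) (S T : Finset V) :
    cutValue w (S ∩ T) + cutValue w (S ∪ T) ≤ cutValue w S + cutValue w T := by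
  simp only [cutValue_eq_sum_ite, ← sum_add_distrib]
  refine sum_le_sum fun x _ => sum_le_sum fun y _ => ?_
  have := hnonneg x y
  by_cases x ∈ S <;> by_cases x ∈ T <;> by_cases y ∈ S <;> by_cases y ∈ T <;> simp [*]

theorem cut_gt_of_not_latest_subset [Fintype V] [DecidableEq V] [Nonempty V] (w : V → V → ℝ)
    (hsymm : ∀ x y, w x y = w y x) (hnonneg : ∀ x y, 0 ≤ w x y)
    (hzero : ∀ x, w x x = 0)
    (u p : V) (hup : u ≠ p)
    (L : Finset V) (hL : IsLatestMinCutSide w u p L)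
    (A : Finset V) (hA : IsCutSide u p A) (hnsub : ¬ L ⊆ A) :
    cutValue w A > cutValue w L := by
  obtain ⟨⟨⟨huL, hpL⟩, hmin⟩, hcard⟩ := hL
  obtain ⟨huA, hpA⟩ := hA
  by_contra! hle
  have hsub := cutValue_inter_add_cutValue_union_le hnonneg L A
  have hunion := hmin (L ∪ A) ⟨mem_union_left _ huL, by simp [hpL, hpA]⟩
  have hinter : IsMinCutSide w u p (L ∩ A) :=
    ⟨⟨mem_inter.2 ⟨huL, huA⟩, fun h => hpL (mem_inter.1 h).1⟩,
      fun S' hS' => by linarith [hmin S' hS']⟩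
  exact hnsub (inter_eq_left.1 (eq_of_subset_of_card_le inter_subset_left (hcard _ hinter)))
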